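/- Let a ∈ ℙ^n and let (Δ, π) be a pure balanced complex of type a. If (Δ, π) is color-shifted, then Δ is a-Macaulay decomposable. -/

import Mathlib

open Finset

/-- The vertex set of a finite simplicial complex, given as its finite set of faces. -/
def vertexSet {α : Type*} [DecidableEq α] (Δ : Finset (Finset α)) : Finset α := Δ.sup id

/-- `Δ` is a (finite) simplicial complex: a nonempty collection of finite subsets
closed under taking subsets.  (Every member of some face then automatically spans
a face, so the vertex condition is automatic.) -/
def IsSimplicialComplex {α : Type*} (Δ : Finset (Finset α)) : Prop :=
  Δ.Nonempty ∧ ∀ F ∈ Δ, ∀ G ⊆ F, G ∈ Δ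

/-- The deletion `dl_Δ(x)` of the vertex `x` from `Δ`. -/
def del {α : Type*} [DecidableEq α] (Δ : Finset (Finset α)) (x : α) : Finset (Finset α) :=
  Δ.filter fun τ => x ∉ τ

/-- The link `lk_Δ(x)` of the vertex `x` in `Δ`. -/
def lk {α : Type*} [DecidableEq α] (Δ : Finset (Finset α)) (x : α) : Finset (Finset α) :=
  Δ.filter fun τ => x ∉ τ ∧ insert x τ ∈ Δ

/-- `F` is a facet (maximal face) of `Δ`. -/
def IsFacet {α : Type*} (Δ : Finset (Finset α)) (F : Finset α) : Prop :=
  F ∈ Δ ∧ ∀ G ∈ Δ, F ⊆ G → G = F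

/-- The simplicial complex `⟨ℱ⟩` generated by a collection `ℱ` of faces. -/
def generatedComplex {α : Type*} [DecidableEq α] (S : Finset (Finset α)) :
    Finset (Finset α) :=
  insert ∅ (S.biUnion Finset.powerset)

/-- `(V 0, …, V (n-1))` is an ordered partition of `W` into nonempty parts. -/
def IsOrderedPartition {α : Type*} [DecidableEq α] {n : ℕ} (V : Fin n → Finset α)
    (W : Finset α) : Prop :=
  (∀ i, (V i).Nonempty) ∧ (∀ i j, i ≠ j → Disjoint (V i) (V j)) ∧
    Finset.univ.biUnion V = W

/-- `Γ` is an `a`-rib of `Δ`: there is an ordered partition `V` of the vertex set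
of `Δ` such that `Γ` is generated by the faces `F` of `Δ` with `|F ∩ V i| = a i`
for every `i`. -/
def IsRib {α : Type*} [DecidableEq α] {n : ℕ} (a : Fin n → ℕ) (Δ Γ : Finset (Finset α)) :
    Prop :=
  ∃ V : Fin n → Finset α, IsOrderedPartition V (vertexSet Δ) ∧
    (Δ.filter fun F => ∀ i, (F ∩ V i).card = a i).Nonempty ∧
    Γ = generatedComplex (Δ.filter fun F => ∀ i, (F ∩ V i).card = a i)

/-- `Γ` is an `a`-rib of a simplex. -/
def IsRibOfSimplex {α : Type*} [DecidableEq α] {n : ℕ} (a : Fin n → ℕ)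
    (Γ : Finset (Finset α)) : Prop :=
  ∃ F : Finset α, F.Nonempty ∧ IsRib a F.powerset Γ

/-- Vertex decomposability, in the non-pure sense of Björner and Wachs. -/
inductive VertexDecomposable {α : Type*} [DecidableEq α] : Finset (Finset α) → Prop
  | simplex (F : Finset α) (hF : F.Nonempty) : VertexDecomposable F.powerset
  | ofEmpty : VertexDecomposable {∅}
  | shed (Δ : Finset (Finset α)) (x : α) (hC : IsSimplicialComplex Δ) (hx : {x} ∈ Δ)
      (hdl : VertexDecomposable (del Δ x)) (hlk : VertexDecomposable (lk Δ x))
      (hfac : ∀ F, IsFacet (lk Δ x) F → ¬ IsFacet (del Δ x) F) :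
      VertexDecomposable Δ

/-- `a`-Macaulay decomposability. -/
inductive MacaulayDecomposable {α : Type*} [DecidableEq α] {n : ℕ} :
    (Fin n → ℕ) → Finset (Finset α) → Prop
  | rib (a : Fin n → ℕ) (Γ : Finset (Finset α)) (h : IsRibOfSimplex a Γ) :
      MacaulayDecomposable a Γ
  | shed (a a' : Fin n → ℕ) (Δ : Finset (Finset α)) (x : α)
      (hC : IsSimplicialComplex Δ) (hx : {x} ∈ Δ) (hlt : a' < a)
      (hdl : MacaulayDecomposable a (del Δ x))
      (hlk : MacaulayDecomposable a' (lk Δ x))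
      (hfac : ∀ F, IsFacet (lk Δ x) F → ¬ IsFacet (del Δ x) F) :
      MacaulayDecomposable a Δ

/-- `(Δ, V)` is a colored complex of type `a`. -/
def IsColoredComplex {α : Type*} [DecidableEq α] {n : ℕ} (a : Fin n → ℕ)
    (Δ : Finset (Finset α)) (V : Fin n → Finset α) : Prop :=
  IsSimplicialComplex Δ ∧ IsOrderedPartition V (vertexSet Δ) ∧
    ∀ F ∈ Δ, ∀ i, (F ∩ V i).card ≤ a i

/-- `(Δ, V)` is a balanced complex of type `a`: an `a`-colored complex of
dimension `|a| - 1`. -/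
def IsBalancedComplex {α : Type*} [DecidableEq α] {n : ℕ} (a : Fin n → ℕ)
    (Δ : Finset (Finset α)) (V : Fin n → Finset α) : Prop :=
  IsColoredComplex a Δ V ∧ (∀ F ∈ Δ, F.card ≤ ∑ i, a i) ∧ ∃ F ∈ Δ, F.card = ∑ i, a i

/-- `(Δ, V)` is color-shifted (with respect to the linear order on the vertices). -/
def IsColorShifted {α : Type*} [LinearOrder α] {n : ℕ} (Δ : Finset (Finset α))
    (V : Fin n → Finset α) : Prop :=
  ∀ F ∈ Δ, ∀ i : Fin n, ∀ v ∈ V i, ∀ v' ∈ V i,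
    v' < v → v ∈ F → v' ∉ F → insert v' (F.erase v) ∈ Δ

/-- `Δ` is pure: all facets have the same dimension. -/
def IsPureComplex {α : Type*} (Δ : Finset (Finset α)) : Prop :=
  ∀ F G, IsFacet Δ F → IsFacet Δ G → F.card = G.card

/-- `Δ` is a color-shifted complex on the disjoint nonempty color classes `V`, in which every face
extends to a face with exactly `a i` vertices of each color `i`.  Unlike for balanced complexes,
`a` may vanish somewhere and the color classes may contain points that are not vertices. -/
structure IsShiftedOfType {α : Type*} [LinearOrder α] {n : ℕ} (a : Fin n → ℕ)
    (Δ : Finset (Finset α)) (V : Fin n → Finset α) : Prop where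
  complex : IsSimplicialComplex Δ
  nonempty : ∀ i, (V i).Nonempty
  disjoint : ∀ i j, i ≠ j → Disjoint (V i) (V j)
  subset : ∀ F ∈ Δ, F ⊆ univ.biUnion V
  extend : ∀ F ∈ Δ, ∃ G ∈ Δ, F ⊆ G ∧ ∀ i, (G ∩ V i).card = a i
  shifted : IsColorShifted Δ V

theorem card_inter_erase_of_notMem {α : Type*} [DecidableEq α] {F W : Finset α} {x : α}
    (hx : x ∉ F) : (F ∩ W.erase x).card = (F ∩ W).card := by
  congr 1
  grind

theorem card_eq_sum_card_inter {α : Type*} [DecidableEq α] {n : ℕ} {V : Fin n → Finset α}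
    (hV : ∀ i j, i ≠ j → Disjoint (V i) (V j)) {F : Finset α} (hF : F ⊆ univ.biUnion V) :
    F.card = ∑ i, (F ∩ V i).card := by
  rw [← card_biUnion fun i _ j _ hij =>
    (hV i j hij).mono inter_subset_right inter_subset_right, ← inter_biUnion,
    inter_eq_left.2 hF]

theorem vertexSet_powerset {α : Type*} [DecidableEq α] (F : Finset α) :
    vertexSet F.powerset = F :=
  le_antisymm (Finset.sup_le fun _ hG => mem_powerset.1 hG)
    (le_sup (f := id) (mem_powerset_self F))

theorem del_eq_self {α : Type*} [DecidableEq α] {Δ : Finset (Finset α)} {x : α}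
    (hΔ : IsSimplicialComplex Δ) (hx : {x} ∉ Δ) : del Δ x = Δ :=
  filter_true_of_mem fun F hF hxF => hx (hΔ.2 F hF _ (singleton_subset_iff.2 hxF))

namespace IsShiftedOfType

variable {α : Type*} [LinearOrder α] {n : ℕ} {a : Fin n → ℕ} {Δ : Finset (Finset α)}
  {V : Fin n → Finset α}

theorem card_inter_of_isFacet (h : IsShiftedOfType a Δ V) {F : Finset α} (hF : IsFacet Δ F)
    (i : Fin n) : (F ∩ V i).card = a i := by
  obtain ⟨G, hG, hFG, hc⟩ := h.extend F hF.1
  rw [← hF.2 G hG hFG]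
  exact hc i

theorem erase_nonempty (h : IsShiftedOfType a Δ V) {i : Fin n} {x : α} (hx : x ∈ V i)
    (hi : 1 < (V i).card) (j : Fin n) : ((V j).erase x).Nonempty := by
  by_cases hj : j = i
  · subst hj
    rw [← card_pos, card_erase_of_mem hx]
    omega
  · rw [erase_eq_of_notMem fun hxj => disjoint_left.1 (h.disjoint j i hj) hxj hx]
    exact h.nonempty j

protected theorem del (h : IsShiftedOfType a Δ V) {i : Fin n} {x : α} (hx : x ∈ V i)
    (hmax : ∀ v ∈ V i, v ≤ x) (hpos : 0 < a i) (hlt : a i < (V i).card) :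
    IsShiftedOfType a (del Δ x) fun j => (V j).erase x where
  complex := by
    obtain ⟨⟨F, hF⟩, hdown⟩ := h.complex
    refine ⟨⟨∅, by simpa [_root_.del] using hdown F hF ∅ (empty_subset F)⟩, fun F hF G hGF => ?_⟩
    rw [_root_.del, mem_filter] at hF ⊢
    exact ⟨hdown F hF.1 G hGF, fun hxG => hF.2 (hGF hxG)⟩
  nonempty := h.erase_nonempty hx (by omega)
  disjoint j k hjk := (h.disjoint j k hjk).mono (erase_subset _ _) (erase_subset _ _)
  subset F hF y hy := by
    rw [_root_.del, mem_filter] at hF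
    have := h.subset F hF.1 hy
    grind
  extend F hF := by
    rw [_root_.del, mem_filter] at hF
    obtain ⟨G, hG, hFG, hc⟩ := h.extend F hF.1
    by_cases hxG : x ∈ G
    · obtain ⟨v, hv, hvG⟩ : ∃ v ∈ V i, v ∉ G := by
        by_contra! hsub
        have := hc i
        rw [inter_eq_right.2 hsub] at this
        omega
      have hvx : v ≠ x := fun e => hvG (e ▸ hxG)
      refine ⟨insert v (G.erase x), ?_, ?_, fun j => ?_⟩
      · rw [_root_.del, mem_filter]
        exact ⟨h.shifted G hG i x hx v hv (lt_of_le_of_ne (hmax v hv) hvx) hxG hvG, by grind⟩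
      · grind
      · rw [card_inter_erase_of_notMem (by grind), ← hc j]
        by_cases hj : j = i
        · subst hj
          rw [insert_inter_of_mem hv, card_insert_of_notMem (by grind), erase_inter,
            card_erase_of_mem (by grind)]
          have : 0 < (G ∩ V j).card := by rw [hc]; exact hpos
          omega
        · have hvj : v ∉ V j := fun hvj => disjoint_left.1 (h.disjoint j i hj) hvj hv
          have hxj : x ∉ V j := fun hxj => disjoint_left.1 (h.disjoint j i hj) hxj hx
          congr 1
          grind
    · refine ⟨G, ?_, hFG, fun j => ?_⟩
      · rw [_root_.del, mem_filter]
        exact ⟨hG, hxG⟩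
      · rw [card_inter_erase_of_notMem hxG, hc j]
  shifted F hF j v hv v' hv' hlt' hvF hv'F := by
    rw [_root_.del, mem_filter] at hF ⊢
    exact ⟨h.shifted F hF.1 j v (mem_of_mem_erase hv) v' (mem_of_mem_erase hv') hlt' hvF hv'F,
      by grind⟩

protected theorem lk (h : IsShiftedOfType a Δ V) {i : Fin n} {x : α} (hx : x ∈ V i)
    (hxΔ : {x} ∈ Δ) (hi : 1 < (V i).card) :
    IsShiftedOfType (Function.update a i (a i - 1)) (lk Δ x) fun j => (V j).erase x where
  complex := by
    have hdown := h.complex.2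
    refine ⟨⟨∅, ?_⟩, fun F hF G hGF => ?_⟩
    · rw [_root_.lk, mem_filter]
      exact ⟨hdown _ hxΔ ∅ (empty_subset _), by simp, by simpa using hxΔ⟩
    · rw [_root_.lk, mem_filter] at hF ⊢
      exact ⟨hdown F hF.1 G hGF, fun hxG => hF.2.1 (hGF hxG),
        hdown _ hF.2.2 _ (insert_subset_insert x hGF)⟩
  nonempty := h.erase_nonempty hx hi
  disjoint j k hjk := (h.disjoint j k hjk).mono (erase_subset _ _) (erase_subset _ _)
  subset F hF y hy := by
    rw [_root_.lk, mem_filter] at hF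
    have := h.subset F hF.1 hy
    grind
  extend F hF := by
    rw [_root_.lk, mem_filter] at hF
    obtain ⟨G, hG, hFG, hc⟩ := h.extend _ hF.2.2
    have hxG : x ∈ G := hFG (mem_insert_self x F)
    refine ⟨G.erase x, ?_, by grind, fun j => ?_⟩
    · rw [_root_.lk, mem_filter, insert_erase hxG]
      exact ⟨h.complex.2 G hG _ (erase_subset x G), notMem_erase x G, hG⟩
    · rw [card_inter_erase_of_notMem (notMem_erase x G), erase_inter]
      by_cases hj : j = i
      · subst hj
        rw [card_erase_of_mem (by grind), hc, Function.update_self]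
      · have hxj : x ∉ V j := fun hxj => disjoint_left.1 (h.disjoint j i hj) hxj hx
        rw [erase_eq_of_notMem (by grind), hc, Function.update_of_ne hj]
  shifted F hF j v hv v' hv' hlt' hvF hv'F := by
    rw [_root_.lk, mem_filter] at hF ⊢
    rw [mem_erase] at hv hv'
    refine ⟨h.shifted F hF.1 j v hv.2 v' hv'.2 hlt' hvF hv'F, by grind, ?_⟩
    have := h.shifted _ hF.2.2 j v hv.2 v' hv'.2 hlt' (mem_insert_of_mem hvF) (by grind)
    rwa [erase_insert_of_ne hv.1.symm, insert_comm] at this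

theorem isRibOfSimplex (hn : 0 < n) (h : IsShiftedOfType a Δ V)
    (hfull : ∀ i, 0 < a i → (V i).card ≤ a i) : IsRibOfSimplex a Δ := by
  have heq : ∀ G G' : Finset α, (∀ i, (G ∩ V i).card = a i) → (∀ i, (G' ∩ V i).card = a i) →
      G ⊆ univ.biUnion V → G ⊆ G' := by
    intro G G' hG hG' hsub y hy
    obtain ⟨i, -, hyi⟩ := mem_biUnion.1 (hsub hy)
    have hpos : 0 < a i := by
      rw [← hG i, card_pos]
      exact ⟨y, mem_inter.2 ⟨hy, hyi⟩⟩
    have hVi : G' ∩ V i = V i :=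
      eq_of_subset_of_card_le inter_subset_right (by rw [hG' i]; exact hfull i hpos)
    exact inter_eq_right.1 hVi hyi
  obtain ⟨F₀, hF₀⟩ := h.complex.1
  obtain ⟨G, hG, -, hc⟩ := h.extend F₀ hF₀
  have hGsub := h.subset G hG
  refine ⟨univ.biUnion V, ?_, V, ⟨h.nonempty, h.disjoint, (vertexSet_powerset _).symm⟩,
    ⟨G, mem_filter.2 ⟨mem_powerset.2 hGsub, hc⟩⟩, ?_⟩
  · obtain ⟨y, hy⟩ := h.nonempty ⟨0, hn⟩
    exact ⟨y, mem_biUnion.2 ⟨_, mem_univ _, hy⟩⟩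
  · ext F
    simp only [generatedComplex, mem_insert, mem_biUnion, mem_filter, mem_powerset]
    constructor
    · intro hF
      obtain ⟨G', hG', hFG', hc'⟩ := h.extend F hF
      exact Or.inr ⟨G', ⟨h.subset G' hG', hc'⟩, hFG'⟩
    · rintro (rfl | ⟨G', ⟨hG', hc'⟩, hFG'⟩)
      · exact h.complex.2 G hG _ (empty_subset G)
      · exact h.complex.2 G hG _ (hFG'.trans (heq G' G hc' hc hG'))

theorem macaulayDecomposable (hn : 0 < n) (h : IsShiftedOfType a Δ V) :
    MacaulayDecomposable a Δ := by
  induction hN : ∑ i, (V i).card using Nat.strong_induction_on generalizing a Δ V with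
  | _ N ih =>
  by_cases hfull : ∀ i, 0 < a i → (V i).card ≤ a i
  · exact .rib a Δ (h.isRibOfSimplex hn hfull)
  push Not at hfull
  obtain ⟨i, hpos, hlt⟩ := hfull
  obtain ⟨x, hx, hmax⟩ : ∃ x ∈ V i, ∀ v ∈ V i, v ≤ x :=
    ⟨(V i).max' (h.nonempty i), max'_mem _ _, fun v hv => le_max' _ v hv⟩
  have hsum : ∑ j, ((V j).erase x).card < N := by
    rw [← hN]
    exact sum_lt_sum (fun j _ => card_le_card (erase_subset _ _))
      ⟨i, mem_univ i, card_erase_lt_of_mem hx⟩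
  have hdelType := h.del hx hmax hpos hlt
  have hdel := ih _ hsum hdelType rfl
  by_cases hxΔ : {x} ∈ Δ
  · have hlkType := h.lk hx hxΔ (by omega)
    refine .shed a _ Δ x h.complex hxΔ ?_ hdel (ih _ hsum hlkType rfl) fun F hF hF' => ?_
    · rw [update_lt_self_iff]
      omega
    · have hcard := hlkType.card_inter_of_isFacet hF i
      rw [hdelType.card_inter_of_isFacet hF' i, Function.update_self] at hcard
      omega
  · rwa [del_eq_self h.complex hxΔ] at hdel

end IsShiftedOfType

theorem exists_isFacet_superset {α : Type*} {Δ : Finset (Finset α)} {F : Finset α}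
    (hF : F ∈ Δ) : ∃ G, F ⊆ G ∧ IsFacet Δ G := by
  obtain ⟨G, hFG, hG⟩ := Δ.exists_le_maximal hF
  exact ⟨G, hFG, hG.prop, fun H hH hGH => (hG.eq_of_le hH hGH).symm⟩

theorem IsBalancedComplex.isShiftedOfType {α : Type*} [LinearOrder α] {n : ℕ} {a : Fin n → ℕ}
    {Δ : Finset (Finset α)} {V : Fin n → Finset α} (hbal : IsBalancedComplex a Δ V)
    (hpure : IsPureComplex Δ) (hcs : IsColorShifted Δ V) : IsShiftedOfType a Δ V := by
  obtain ⟨⟨hC, ⟨hne, hdisj, hunion⟩, hcol⟩, hdim, F₀, hF₀, hcard₀⟩ := hbal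
  have hsub : ∀ F ∈ Δ, F ⊆ univ.biUnion V := fun F hF => by
    rw [hunion]
    exact le_sup (f := id) hF
  refine ⟨hC, hne, hdisj, hsub, fun F hF => ?_, hcs⟩
  obtain ⟨G, hFG, hG⟩ := exists_isFacet_superset hF
  obtain ⟨G₀, hFG₀, hG₀⟩ := exists_isFacet_superset hF₀
  have hcard : ∑ i, (G ∩ V i).card = ∑ i, a i := by
    rw [← card_eq_sum_card_inter hdisj (hsub G hG.1), hpure G G₀ hG hG₀]
    exact le_antisymm (hdim G₀ hG₀.1) (hcard₀ ▸ card_le_card hFG₀)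
  exact ⟨G, hG.1, hFG, fun i =>
    (sum_eq_sum_iff_of_le fun i _ => hcol G hG.1 i).1 hcard i (mem_univ i)⟩

/-- A pure color-shifted balanced complex of type `a` is
`a`-Macaulay decomposable. -/
theorem colorShifted_macaulayDecomposable {α : Type*} [LinearOrder α] {n : ℕ}
    (hn : 0 < n) (a : Fin n → ℕ) (ha : ∀ i, 0 < a i)
    (Δ : Finset (Finset α)) (V : Fin n → Finset α)
    (hbal : IsBalancedComplex a Δ V) (hpure : IsPureComplex Δ)
    (hcs : IsColorShifted Δ V) :
    MacaulayDecomposable a Δ := by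
  exact (hbal.isShiftedOfType hpure hcs).macaulayDecomposable hn
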